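/- arXiv:1508.00980 — 5 statements merged into one kernel-verified Lean document; each statement's English description precedes it below -/
import Mathlib

section
/- Let G be a discrete group and let L be a length function on G with bounded doubling. Then the set { λ_f : f : G → ℂ finitely supported, f(e) = 0, and ‖[D, λ_f]‖ ≤ 1 } is totally bounded in the space of bounded linear operators on ℓ²(G) with the operator-norm metric. (This is the criterion equivalent to the seminorm L_D(f) = ‖[D, λ_f]‖ being a Lip-norm on the reduced group C*-algebra of G.) -/
open scoped ENNReal ComplexConjugate

noncomputable section

variable {G : Type*}

/-- The Hilbert space `ℓ²(G)` of square-summable complex-valued functions on `G`. -/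
abbrev l2 (G : Type*) : Type _ := lp (fun _ : G => ℂ) 2

variable [Group G]

/-- A length function on a group `G`: subadditive, symmetric under inverses,
and vanishing exactly at the identity. -/
structure IsLengthFunction (L : G → ℝ) : Prop where
  nonneg : ∀ x, 0 ≤ L x
  subadd : ∀ x y, L (x * y) ≤ L x + L y
  inv_eq : ∀ x, L x⁻¹ = L x
  eq_zero_iff : ∀ x, L x = 0 ↔ x = 1

/-- The ball `B(r) = {x ∈ G : L x ≤ r}`. -/
def lball (L : G → ℝ) (r : ℝ) : Set G := {x : G | L x ≤ r}

/-- A length function is proper if all balls are finite. -/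
def IsProperLF (L : G → ℝ) : Prop := ∀ r : ℝ, (lball L r).Finite

/-- Bounded doubling: `L` is proper and there is `C < ∞` with
`|B(2r)| ≤ C |B(r)|` for all `r ≥ 1`. -/
def HasBoundedDoubling (L : G → ℝ) : Prop :=
  IsProperLF L ∧ ∃ C : ℝ, ∀ r : ℝ, 1 ≤ r →
    ((lball L (2 * r)).ncard : ℝ) ≤ C * ((lball L r).ncard : ℝ)

/-- `T` is the convolution operator `λ_f`, `(λ_f ξ)(x) = Σ_y f(xy⁻¹) ξ(y)`. -/
def IsConvOp (f : G → ℂ) (T : l2 G →L[ℂ] l2 G) : Prop :=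
  ∀ (ξ : l2 G) (x : G), T ξ x = ∑' y : G, f (x * y⁻¹) * ξ y

/-- `T` is the commutator `[D, λ_f]` for `D = M_L`, i.e.
`([D,λ_f] ξ)(x) = Σ_y (L x − L y) f(xy⁻¹) ξ(y)`. -/
def IsCommOp (L : G → ℝ) (f : G → ℂ) (T : l2 G →L[ℂ] l2 G) : Prop :=
  ∀ (ξ : l2 G) (x : G), T ξ x = ∑' y : G, ((L x : ℂ) - (L y : ℂ)) * f (x * y⁻¹) * ξ y

/-- `T` is the truncated operator `(I − M_{2r}) λ_f M_r`. -/
def IsTruncOp (L : G → ℝ) (f : G → ℂ) (r : ℝ) (T : l2 G →L[ℂ] l2 G) : Prop :=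
  ∀ (ξ : l2 G) (x : G),
    T ξ x = if L x ≤ 2 * r then 0
      else ∑' y : G, (if L y ≤ r then f (x * y⁻¹) * ξ y else 0)

/-- The seminorm `J_D(f) = sup_{r>0} r ‖(I − M_{2r}) λ_f M_r‖`. -/
def JD (L : G → ℝ) (f : G → ℂ) : ℝ :=
  sSup {a : ℝ | ∃ r : ℝ, 0 < r ∧ ∃ T : l2 G →L[ℂ] l2 G, IsTruncOp L f r T ∧ a = r * ‖T‖}

/-- The convolution `h* ∗ k`, where `h*(z) = conj (h z⁻¹)`. -/
def starConv (h k : G → ℂ) : G → ℂ :=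
  fun x => ∑' z : G, conj (h z⁻¹) * k (z⁻¹ * x)

/-- The `ℓ²` norm `‖h‖₂ = (Σ_x |h x|²)^{1/2}` of a function `h : G → ℂ`. -/
def l2norm (h : G → ℂ) : ℝ := Real.sqrt (∑' x : G, ‖h x‖ ^ 2)

section KernelBound

variable {X : Type*}

/-- The block of the kernel `a` with rows in `S` and columns in `T` has operator norm at most `N`
on `ℓ²`. -/
def KernelBound (a : X → X → ℂ) (S T : Finset X) (N : ℝ) : Prop :=
  ∀ η ξ : X → ℂ, ‖∑ x ∈ S, ∑ y ∈ T, η x * a x y * ξ y‖ ≤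
    N * √(∑ x ∈ S, ‖η x‖ ^ 2) * √(∑ y ∈ T, ‖ξ y‖ ^ 2)

namespace KernelBound

theorem mono {a : X → X → ℂ} {S T : Finset X} {M N : ℝ} (h : KernelBound a S T M) (hMN : M ≤ N) :
    KernelBound a S T N := fun η ξ => (h η ξ).trans (by gcongr)

theorem add {a b : X → X → ℂ} {S T : Finset X} {M N : ℝ} (ha : KernelBound a S T M)
    (hb : KernelBound b S T N) : KernelBound (fun x y => a x y + b x y) S T (M + N) := fun η ξ => by
  simp only [mul_add, add_mul, Finset.sum_add_distrib]
  exact (norm_add_le _ _).trans (add_le_add (ha η ξ) (hb η ξ))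

theorem const_mul {a : X → X → ℂ} {S T : Finset X} {N : ℝ} (c : ℂ) (h : KernelBound a S T N) :
    KernelBound (fun x y => c * a x y) S T (‖c‖ * N) := fun η ξ => by
  have : ∑ x ∈ S, ∑ y ∈ T, η x * (c * a x y) * ξ y
      = c * ∑ x ∈ S, ∑ y ∈ T, η x * a x y * ξ y := by
    simp only [Finset.mul_sum]
    exact Finset.sum_congr rfl fun x _ => Finset.sum_congr rfl fun y _ => by ring
  rw [this, norm_mul]
  calc _ ≤ ‖c‖ * _ := mul_le_mul_of_nonneg_left (h η ξ) (norm_nonneg c)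
    _ = _ := by ring

theorem sub {a b : X → X → ℂ} {S T : Finset X} {M N : ℝ} (ha : KernelBound a S T M)
    (hb : KernelBound b S T N) : KernelBound (fun x y => a x y - b x y) S T (M + N) := by
  simpa [sub_eq_add_neg] using ha.add (hb.const_mul (-1))

theorem of_sum_norm (a : X → X → ℂ) (S T : Finset X) :
    KernelBound a S T (∑ x ∈ S, ∑ y ∈ T, ‖a x y‖) := fun η ξ => by
  have key : ∀ (U : Finset X) (v : X → ℂ), ∀ u ∈ U, ‖v u‖ ≤ √(∑ x ∈ U, ‖v x‖ ^ 2) :=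
    fun U v u hu => Real.le_sqrt_of_sq_le
      (Finset.single_le_sum (f := fun x => ‖v x‖ ^ 2) (fun _ _ => by positivity) hu)
  simp only [Finset.sum_mul]
  refine (norm_sum_le _ _).trans (Finset.sum_le_sum fun x hx => ?_)
  refine (norm_sum_le _ _).trans (Finset.sum_le_sum fun y hy => ?_)
  rw [norm_mul, norm_mul, mul_comm ‖η x‖]
  gcongr
  exacts [key S η x hx, key T ξ y hy]

/-- A kernel whose commutator with multiplication by `L` is bounded is itself bounded on a block
where the row values of `L` exceed `2r` and the column values are at most `r`. -/
theorem of_commutator {a : X → X → ℂ} {L : X → ℝ} (hL : ∀ x, 0 ≤ L x) {S T : Finset X} {N r : ℝ}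
    (hr : 0 < r) (hN : 0 ≤ N) (hS : ∀ x ∈ S, 2 * r ≤ L x) (hT : ∀ y ∈ T, L y ≤ r)
    (h : KernelBound (fun x y => ((L x : ℂ) - L y) * a x y) S T N) :
    KernelBound a S T (N / r) := by
  have step : ∀ M, 0 ≤ M → KernelBound a S T M → KernelBound a S T (N / (2 * r) + M / 2) := by
    intro M hM ha η ξ
    have hη : √(∑ x ∈ S, ‖η x / L x‖ ^ 2) ≤ (2 * r)⁻¹ * √(∑ x ∈ S, ‖η x‖ ^ 2) := by
      rw [← Real.sqrt_sq (by positivity : (0 : ℝ) ≤ (2 * r)⁻¹), ← Real.sqrt_mul (by positivity),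
        Finset.mul_sum]
      refine Real.sqrt_le_sqrt (Finset.sum_le_sum fun x hx => ?_)
      rw [norm_div, Complex.norm_real, Real.norm_of_nonneg (hL x), ← mul_pow, ← div_eq_inv_mul]
      have := div_nonneg (norm_nonneg (η x)) (hL x)
      gcongr
      exact hS x hx
    have hξ : √(∑ y ∈ T, ‖(L y : ℂ) * ξ y‖ ^ 2) ≤ r * √(∑ y ∈ T, ‖ξ y‖ ^ 2) := by
      rw [← Real.sqrt_sq hr.le, ← Real.sqrt_mul (by positivity), Finset.mul_sum]
      refine Real.sqrt_le_sqrt (Finset.sum_le_sum fun y hy => ?_)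
      rw [norm_mul, Complex.norm_real, Real.norm_of_nonneg (hL y), ← mul_pow]
      have := hL y
      gcongr
      exact hT y hy
    have split : ∑ x ∈ S, ∑ y ∈ T, η x * a x y * ξ y
        = (∑ x ∈ S, ∑ y ∈ T, (η x / L x) * (((L x : ℂ) - L y) * a x y) * ξ y)
          + ∑ x ∈ S, ∑ y ∈ T, (η x / L x) * a x y * (L y * ξ y) := by
      rw [← Finset.sum_add_distrib]
      refine Finset.sum_congr rfl fun x hx => ?_
      rw [← Finset.sum_add_distrib]
      refine Finset.sum_congr rfl fun y _ => ?_
      have : (L x : ℂ) ≠ 0 := by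
        have := hS x hx
        exact_mod_cast (by linarith : 0 < L x).ne'
      field_simp
      ring
    rw [split]
    refine (norm_add_le _ _).trans ((add_le_add (h (fun x => η x / L x) ξ)
      (ha (fun x => η x / L x) fun y => L y * ξ y)).trans ?_)
    calc _ ≤ N * ((2 * r)⁻¹ * √(∑ x ∈ S, ‖η x‖ ^ 2)) * √(∑ y ∈ T, ‖ξ y‖ ^ 2)
          + M * ((2 * r)⁻¹ * √(∑ x ∈ S, ‖η x‖ ^ 2)) * (r * √(∑ y ∈ T, ‖ξ y‖ ^ 2)) := by
          gcongr
      _ = _ := by field_simp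
  set M := ∑ x ∈ S, ∑ y ∈ T, ‖a x y‖ with hM
  have hM0 : 0 ≤ M := by positivity
  have iter : ∀ n : ℕ, KernelBound a S T (N / r + M * (1 / 2) ^ n) := by
    intro n
    induction n with
    | zero =>
      have : 0 ≤ N / r := by positivity
      exact (of_sum_norm a S T).mono (by simp [← hM, this])
    | succ n ih =>
      refine (step _ (by positivity) ih).mono (le_of_eq ?_)
      rw [pow_succ]
      field_simp
      ring
  intro η ξ
  have lim : Filter.Tendsto (fun n : ℕ => (N / r + M * (1 / 2 : ℝ) ^ n) *
      √(∑ x ∈ S, ‖η x‖ ^ 2) * √(∑ y ∈ T, ‖ξ y‖ ^ 2)) Filter.atTop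
      (nhds ((N / r + M * 0) * √(∑ x ∈ S, ‖η x‖ ^ 2) * √(∑ y ∈ T, ‖ξ y‖ ^ 2))) :=
    (((tendsto_pow_atTop_nhds_zero_of_lt_one (by norm_num) (by norm_num)).const_mul M).const_add
      (N / r)).mul_const _ |>.mul_const _
  simpa using ge_of_tendsto' lim fun n => iter n η ξ

end KernelBound

end KernelBound

/-- The block of the convolution kernel of `f` with rows in `S` and columns in `T` has operator
norm at most `N` on `ℓ²`. -/
def ConvBound (f : G → ℂ) (S T : Finset G) (N : ℝ) : Prop :=
  KernelBound (fun x y => f (x * y⁻¹)) S T N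

open scoped Classical in
/-- The number of `b ∈ K` with `t b ∈ H`. -/
def overlap (H K : Finset G) (t : G) : ℕ := (K.filter fun b => t * b ∈ H).card

theorem sum_ite_equiv {α : Type*} [DecidableEq α] {M : Type*} [AddCommMonoid M]
    (e : α ≃ α) (S H : Finset α) (F : α → M) :
    ∑ x ∈ S, (if e x ∈ H then F x else 0)
      = ∑ z ∈ H, if e.symm z ∈ S then F (e.symm z) else 0 := by
  rw [← Finset.sum_filter, ← Finset.sum_filter]
  refine Finset.sum_nbij' e e.symm ?_ ?_ ?_ ?_ ?_ <;> simp +contextual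

/-- Multiplying a convolution kernel by `overlap H K` turns a bound for the block `H × K` into a
bound for every block. -/
theorem ConvBound.mul_overlap {f : G → ℂ} {H K : Finset G} {N : ℝ} (hN : 0 ≤ N)
    (h : ConvBound f H K N) (S T : Finset G) :
    ConvBound (fun t => f t * overlap H K t) S T (N * √H.card * √K.card) := by
  classical
  intro η ξ
  let C := Finset.image₂ (fun y w => y⁻¹ * w) T K
  let cut : Finset G → (G → ℂ) → G → ℂ := fun U v x => if x ∈ U then v x else 0
  let e : G → G ≃ G := fun w => (Equiv.inv G).trans (Equiv.mulLeft w)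
  have he : ∀ w c, e w c = w * c⁻¹ := fun _ _ => rfl
  have he' : ∀ w y, (e w).symm y = y⁻¹ * w := fun w y => by
    rw [Equiv.symm_apply_eq, he]; group
  have inner : ∀ z ∈ H, ∀ w ∈ K,
      ∑ c ∈ C, cut S η (z * c⁻¹) * f (z * w⁻¹) * cut T ξ (w * c⁻¹)
        = ∑ y ∈ T, cut S η (z * w⁻¹ * y) * f (z * w⁻¹) * ξ y := by
    intro z _ w hw
    have := sum_ite_equiv (e w) C T
      fun c => cut S η (z * c⁻¹) * f (z * w⁻¹) * ξ (w * c⁻¹)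
    simp only [he, he'] at this
    simp only [cut, mul_ite, mul_zero] at this ⊢
    rw [this]
    refine Finset.sum_congr rfl fun y hy => ?_
    rw [if_pos (Finset.mem_image₂_of_mem hy hw)]
    simp [mul_assoc]
  have outer : ∀ y w, ∑ x ∈ S, (if x * y⁻¹ * w ∈ H then η x * f (x * y⁻¹) * ξ y else 0)
      = ∑ z ∈ H, cut S η (z * w⁻¹ * y) * f (z * w⁻¹) * ξ y := by
    intro y w
    have := sum_ite_equiv (Equiv.mulRight (y⁻¹ * w)) S H
      fun x => η x * f (x * y⁻¹) * ξ y
    simp only [Equiv.coe_mulRight, Equiv.mulRight_symm_apply, mul_inv_rev, inv_inv,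
      ← mul_assoc] at this
    rw [this]
    refine Finset.sum_congr rfl fun z _ => ?_
    simp [cut, mul_assoc]
  have expand : ∑ x ∈ S, ∑ y ∈ T, η x * (f (x * y⁻¹) * overlap H K (x * y⁻¹)) * ξ y
      = ∑ c ∈ C, ∑ z ∈ H, ∑ w ∈ K, cut S η (z * c⁻¹) * f (z * w⁻¹) * cut T ξ (w * c⁻¹) := by
    calc _ = ∑ x ∈ S, ∑ y ∈ T, ∑ w ∈ K,
          (if x * y⁻¹ * w ∈ H then η x * f (x * y⁻¹) * ξ y else 0) := by
          refine Finset.sum_congr rfl fun x _ => Finset.sum_congr rfl fun y _ => ?_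
          rw [overlap, ← Finset.sum_filter, Finset.sum_const, nsmul_eq_mul]
          ring
      _ = ∑ y ∈ T, ∑ w ∈ K, ∑ z ∈ H, cut S η (z * w⁻¹ * y) * f (z * w⁻¹) * ξ y := by
          rw [Finset.sum_comm]
          refine Finset.sum_congr rfl fun y _ => ?_
          rw [Finset.sum_comm]
          exact Finset.sum_congr rfl fun w _ => outer y w
      _ = ∑ z ∈ H, ∑ w ∈ K, ∑ y ∈ T, cut S η (z * w⁻¹ * y) * f (z * w⁻¹) * ξ y := by
          rw [Finset.sum_comm' (t' := K) (s' := fun _ => T) (by simp)]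
          rw [Finset.sum_comm' (s := H) (t' := K) (s' := fun _ => H) (by simp)]
          exact Finset.sum_congr rfl fun w _ => Finset.sum_comm
      _ = ∑ z ∈ H, ∑ w ∈ K, ∑ c ∈ C,
            cut S η (z * c⁻¹) * f (z * w⁻¹) * cut T ξ (w * c⁻¹) :=
          Finset.sum_congr rfl fun z hz => Finset.sum_congr rfl fun w hw => (inner z hz w hw).symm
      _ = _ := by
          rw [Finset.sum_comm (s := C)]
          exact Finset.sum_congr rfl fun z _ => Finset.sum_comm
  have mass : ∀ (V U : Finset G) (v : G → ℂ),
      √(∑ c ∈ C, ∑ z ∈ V, ‖cut U v (z * c⁻¹)‖ ^ 2) ≤ √V.card * √(∑ x ∈ U, ‖v x‖ ^ 2) := by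
    intro V U v
    rw [← Real.sqrt_mul (by positivity)]
    refine Real.sqrt_le_sqrt ?_
    rw [Finset.sum_comm, ← nsmul_eq_mul]
    refine Finset.sum_le_card_nsmul _ _ _ fun z _ => ?_
    have := sum_ite_equiv (e z) C U fun c => ‖v (z * c⁻¹)‖ ^ 2
    simp only [he, he'] at this
    calc _ = ∑ c ∈ C, (if z * c⁻¹ ∈ U then ‖v (z * c⁻¹)‖ ^ 2 else 0) :=
          Finset.sum_congr rfl fun c _ => by simp only [cut]; split_ifs <;> simp
      _ ≤ _ := by
          rw [this]
          refine Finset.sum_le_sum fun x _ => ?_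
          split_ifs
          · simp
          · positivity
  rw [expand]
  calc _ ≤ ∑ c ∈ C, N * (√(∑ z ∈ H, ‖cut S η (z * c⁻¹)‖ ^ 2) *
          √(∑ w ∈ K, ‖cut T ξ (w * c⁻¹)‖ ^ 2)) := by
        refine (norm_sum_le _ _).trans (Finset.sum_le_sum fun c _ => ?_)
        rw [← mul_assoc]
        exact h (fun z => cut S η (z * c⁻¹)) fun w => cut T ξ (w * c⁻¹)
    _ ≤ N * (√(∑ c ∈ C, ∑ z ∈ H, ‖cut S η (z * c⁻¹)‖ ^ 2) *
          √(∑ c ∈ C, ∑ w ∈ K, ‖cut T ξ (w * c⁻¹)‖ ^ 2)) := by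
        rw [← Finset.mul_sum]
        gcongr
        exact Real.sum_sqrt_mul_sqrt_le _ (fun _ => by positivity) fun _ => by positivity
    _ ≤ N * ((√H.card * √(∑ x ∈ S, ‖η x‖ ^ 2)) * (√K.card * √(∑ y ∈ T, ‖ξ y‖ ^ 2))) := by
        gcongr
        exacts [mass H S η, mass K T ξ]
    _ = _ := by ring

section MatrixCoefficients

variable {X : Type*}

theorem l2_sqrt_sum_le_norm (v : l2 X) (S : Finset X) : √(∑ x ∈ S, ‖v x‖ ^ 2) ≤ ‖v‖ := by
  have := lp.sum_rpow_le_norm_rpow (p := 2) (by norm_num) v S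
  exact Real.sqrt_le_iff.2 ⟨norm_nonneg _, by simpa using this⟩

variable [DecidableEq X]

theorem l2_norm_sum_single (ξ : X → ℂ) (S : Finset X) :
    ‖(∑ y ∈ S, lp.single 2 y (ξ y) : l2 X)‖ = √(∑ y ∈ S, ‖ξ y‖ ^ 2) := by
  have := lp.norm_sum_single (p := 2) (E := fun _ : X => ℂ) (by norm_num) ξ S
  rw [eq_comm, Real.sqrt_eq_iff_mul_self_eq (by positivity) (norm_nonneg _), ← sq]
  simpa using this.symm

theorem l2_map_sum_single_apply (T : l2 X →L[ℂ] l2 X) (ξ : X → ℂ) (S : Finset X) (x : X) :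
    T (∑ y ∈ S, lp.single 2 y (ξ y)) x = ∑ y ∈ S, T (lp.single 2 y 1) x * ξ y := by
  rw [map_sum, lp.coeFn_sum, Finset.sum_apply]
  refine Finset.sum_congr rfl fun y _ => ?_
  rw [show (lp.single 2 y (ξ y) : l2 X) = ξ y • lp.single 2 y 1 by
    rw [← lp.single_smul, smul_eq_mul, mul_one], map_smul, lp.coeFn_smul, Pi.smul_apply,
    smul_eq_mul, mul_comm]

/-- The blocks of the matrix of a bounded operator are bounded by its norm. -/
theorem kernelBound_opNorm (T : l2 X →L[ℂ] l2 X) (S S' : Finset X) :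
    KernelBound (fun x y => T (lp.single 2 y 1) x) S S' ‖T‖ := by
  intro η ξ
  set v : l2 X := ∑ y ∈ S', lp.single 2 y (ξ y) with hv
  have hsum : ∑ x ∈ S, ∑ y ∈ S', η x * T (lp.single 2 y 1) x * ξ y = ∑ x ∈ S, η x * T v x := by
    simp only [hv, l2_map_sum_single_apply, Finset.mul_sum, mul_assoc]
  rw [hsum]
  calc _ ≤ ∑ x ∈ S, ‖η x‖ * ‖T v x‖ := by
        simpa only [norm_mul] using norm_sum_le S fun x => η x * T v x
    _ ≤ √(∑ x ∈ S, ‖η x‖ ^ 2) * √(∑ x ∈ S, ‖T v x‖ ^ 2) := Real.sum_mul_le_sqrt_mul_sqrt _ _ _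
    _ ≤ √(∑ x ∈ S, ‖η x‖ ^ 2) * (‖T‖ * √(∑ y ∈ S', ‖ξ y‖ ^ 2)) := by
        rw [← l2_norm_sum_single ξ, ← hv]
        gcongr
        exact (l2_sqrt_sum_le_norm _ _).trans (T.le_opNorm v)
    _ = _ := by ring

/-- An operator whose matrix has all its blocks bounded by `N` has norm at most `N`. -/
theorem opNorm_le_of_kernelBound {T : l2 X →L[ℂ] l2 X} {N : ℝ} (hN : 0 ≤ N)
    (h : ∀ S S' : Finset X, KernelBound (fun x y => T (lp.single 2 y 1) x) S S' N) :
    ‖T‖ ≤ N := by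
  refine T.opNorm_le_bound hN fun ξ => ?_
  have fin : ∀ S : Finset X, ‖T (∑ y ∈ S, lp.single 2 y (ξ y))‖ ≤
      N * ‖(∑ y ∈ S, lp.single 2 y (ξ y) : l2 X)‖ := by
    intro S
    set v : l2 X := ∑ y ∈ S, lp.single 2 y (ξ y) with hv
    refine lp.norm_le_of_forall_sum_le (by norm_num) (by positivity) fun U => ?_
    have hU := h U S (fun x => conj (T v x)) ξ
    rw [← l2_norm_sum_single ξ, ← hv] at hU
    have hsum : ∑ x ∈ U, ∑ y ∈ S, conj (T v x) * T (lp.single 2 y 1) x * ξ y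
        = ((∑ x ∈ U, ‖T v x‖ ^ 2 : ℝ) : ℂ) := by
      push_cast
      refine Finset.sum_congr rfl fun x _ => ?_
      rw [← Complex.conj_mul', hv, l2_map_sum_single_apply, Finset.mul_sum]
      simp only [mul_assoc]
    have hs : 0 ≤ ∑ x ∈ U, ‖T v x‖ ^ 2 := by positivity
    simp only [hsum, Complex.norm_real, Real.norm_of_nonneg hs, RCLike.norm_conj] at hU
    set s := ∑ x ∈ U, ‖T v x‖ ^ 2
    have hroot : √s ≤ N * ‖v‖ := by
      rcases (Real.sqrt_nonneg s).eq_or_lt with h0 | h0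
      · rw [← h0]; positivity
      · refine le_of_mul_le_mul_right ?_ h0
        rw [Real.mul_self_sqrt hs]
        linarith
    have := (Real.sqrt_le_left (by positivity)).1 hroot
    simpa using this
  have hξ : HasSum (fun y => (lp.single 2 y (ξ y) : l2 X)) ξ :=
    lp.hasSum_single (by norm_num) ξ
  exact le_of_tendsto_of_tendsto' ((T.continuous.norm.tendsto ξ).comp hξ)
    (((continuous_norm.tendsto ξ).comp hξ).const_mul N) fin

end MatrixCoefficients

theorem IsConvOp.apply_single [DecidableEq G] {f : G → ℂ} {T : l2 G →L[ℂ] l2 G}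
    (h : IsConvOp f T) (x y : G) : T (lp.single 2 y 1) x = f (x * y⁻¹) := by
  rw [h, tsum_eq_single y fun z hz => by rw [lp.single_apply_ne _ _ _ hz, mul_zero],
    lp.single_apply_self, mul_one]

theorem IsCommOp.apply_single [DecidableEq G] {L : G → ℝ} {f : G → ℂ} {T : l2 G →L[ℂ] l2 G}
    (h : IsCommOp L f T) (x y : G) :
    T (lp.single 2 y 1) x = ((L x : ℂ) - L y) * f (x * y⁻¹) := by
  rw [h, tsum_eq_single y fun z hz => by rw [lp.single_apply_ne _ _ _ hz, mul_zero],
    lp.single_apply_self, mul_one]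

theorem IsCommOp.kernelBound {L : G → ℝ} {f : G → ℂ} {T : l2 G →L[ℂ] l2 G} (h : IsCommOp L f T)
    (S S' : Finset G) :
    KernelBound (fun x y => ((L x : ℂ) - L y) * f (x * y⁻¹)) S S' ‖T‖ := by
  classical
  simpa only [h.apply_single] using kernelBound_opNorm T S S'

/-- The coefficients of `f` are controlled away from the identity by `‖[D, λ_f]‖`. -/
theorem IsCommOp.norm_apply_le {L : G → ℝ} (hL : IsLengthFunction L) {f : G → ℂ}
    {T : l2 G →L[ℂ] l2 G} (h : IsCommOp L f T) (t : G) : L t * ‖f t‖ ≤ ‖T‖ := by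
  have := h.kernelBound {t} {1} (fun _ => 1) fun _ => 1
  simpa [(hL.eq_zero_iff 1).2 rfl, abs_of_nonneg (hL.nonneg t)] using this

/-- The normalized `overlap`: the proportion of `b ∈ K` with `t b ∈ H`. -/
def cutoff (H K : Finset G) (t : G) : ℂ := (K.card : ℂ)⁻¹ * overlap H K t

theorem cutoff_eq_one {H K : Finset G} (hK : K.Nonempty) {t : G} (h : ∀ b ∈ K, t * b ∈ H) :
    cutoff H K t = 1 := by
  classical
  rw [cutoff, overlap, Finset.filter_true_of_mem h]
  exact inv_mul_cancel₀ (by exact_mod_cast hK.card_pos.ne')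

theorem cutoff_eq_zero {H K : Finset G} {t : G} (h : ∀ b ∈ K, t * b ∉ H) : cutoff H K t = 0 := by
  classical
  rw [cutoff, overlap, Finset.filter_false_of_mem h]
  simp

theorem ConvBound.mono {f : G → ℂ} {S T : Finset G} {M N : ℝ} (hf : ConvBound f S T M)
    (hMN : M ≤ N) : ConvBound f S T N :=
  KernelBound.mono hf hMN

theorem ConvBound.add {f g : G → ℂ} {S T : Finset G} {M N : ℝ} (hf : ConvBound f S T M)
    (hg : ConvBound g S T N) : ConvBound (fun t => f t + g t) S T (M + N) :=
  KernelBound.add hf hg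

theorem ConvBound.sub {f g : G → ℂ} {S T : Finset G} {M N : ℝ} (hf : ConvBound f S T M)
    (hg : ConvBound g S T N) : ConvBound (fun t => f t - g t) S T (M + N) :=
  KernelBound.sub hf hg

theorem ConvBound.mul_cutoff {f : G → ℂ} {H K : Finset G} {N D : ℝ} (hN : 0 ≤ N) (hD : 0 ≤ D)
    (hK : K.Nonempty) (hHK : (H.card : ℝ) ≤ D ^ 2 * K.card) (h : ConvBound f H K N)
    (S T : Finset G) : ConvBound (fun t => f t * cutoff H K t) S T (N * D) := by
  have hK0 : (0 : ℝ) < K.card := by exact_mod_cast hK.card_pos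
  have hsqrt : √H.card ≤ D * √K.card := by
    rw [← Real.sqrt_sq hD, ← Real.sqrt_mul (by positivity)]
    exact Real.sqrt_le_sqrt hHK
  have := KernelBound.const_mul (K.card : ℂ)⁻¹ (h.mul_overlap hN S T)
  have hfun : (fun t => f t * cutoff H K t)
      = fun t => (K.card : ℂ)⁻¹ * (f t * overlap H K t) := by
    funext t; rw [cutoff]; ring
  rw [hfun]
  refine KernelBound.mono this ?_
  rw [norm_inv, Complex.norm_natCast]
  calc _ ≤ (K.card : ℝ)⁻¹ * (N * (D * √K.card) * √K.card) := by gcongr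
    _ = (K.card : ℝ)⁻¹ * (N * D * (√K.card * √K.card)) := by ring
    _ = _ := by rw [Real.mul_self_sqrt hK0.le]; field_simp

/-- The ball of radius `r` of a proper length function, as a finset. -/
def IsProperLF.ball {L : G → ℝ} (hP : IsProperLF L) (r : ℝ) : Finset G := (hP r).toFinset

theorem IsProperLF.mem_ball {X : Type*} {L : X → ℝ} {hP : IsProperLF L} {r : ℝ} {x : X} :
    x ∈ hP.ball r ↔ L x ≤ r := by
  simp [ball, lball]

theorem IsLengthFunction.le_add_mul {L : G → ℝ} (hL : IsLengthFunction L) (t b : G) :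
    L t ≤ L b + L (t * b) := by
  have := hL.subadd (t * b) b⁻¹
  rw [mul_inv_cancel_right, hL.inv_eq] at this
  linarith

theorem IsProperLF.ball_nonempty {L : G → ℝ} (hL : IsLengthFunction L) (hP : IsProperLF L) {r : ℝ}
    (hr : 0 ≤ r) : (hP.ball r).Nonempty :=
  ⟨1, mem_ball.2 (by rwa [(hL.eq_zero_iff 1).2 rfl])⟩

theorem HasBoundedDoubling.exists_card_ball_le {X : Type*} {L : X → ℝ}
    (hBD : HasBoundedDoubling L) :
    ∃ D : ℝ, 0 ≤ D ∧ ∀ r s : ℝ, 1 ≤ r → s ≤ 16 * r →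
      ((hBD.1.ball s).card : ℝ) ≤ D ^ 2 * (hBD.1.ball r).card := by
  obtain ⟨hP, C, hC⟩ := hBD
  have hcard : ∀ r, (lball L r).ncard = (hP.ball r).card := fun r =>
    Set.ncard_eq_toFinset_card _ (hP r)
  simp only [hcard] at hC
  have hC' : ∀ r : ℝ, 1 ≤ r → ((hP.ball (2 * r)).card : ℝ) ≤ |C| * (hP.ball r).card :=
    fun r hr => (hC r hr).trans (by gcongr; exact le_abs_self C)
  refine ⟨|C| ^ 2, by positivity, fun r s hr hs => ?_⟩
  have hsub : hP.ball s ⊆ hP.ball (2 * (2 * (2 * (2 * r)))) := fun x hx =>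
    IsProperLF.mem_ball.2 ((IsProperLF.mem_ball.1 hx).trans (by linarith))
  calc ((hP.ball s).card : ℝ) ≤ (hP.ball (2 * (2 * (2 * (2 * r))))).card := by
        exact_mod_cast Finset.card_le_card hsub
    _ ≤ |C| * (|C| * (|C| * (|C| * (hP.ball r).card))) := by
        refine (hC' _ (by linarith)).trans ?_
        gcongr
        refine (hC' _ (by linarith)).trans ?_
        gcongr
        refine (hC' _ (by linarith)).trans ?_
        gcongr
        exact hC' _ hr
    _ = _ := by ring

/-- A cutoff equal to `1` on `B(3r)` and to `0` off `B(5r)`. -/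
def ballCutoff {L : G → ℝ} (hP : IsProperLF L) (r : ℝ) : G → ℂ :=
  cutoff (hP.ball (4 * r)) (hP.ball r)

theorem ballCutoff_eq_one {L : G → ℝ} (hL : IsLengthFunction L) (hP : IsProperLF L)
    {r : ℝ} (hr : 0 ≤ r) {t : G} (ht : L t ≤ 3 * r) :
    ballCutoff hP r t = 1 :=
  cutoff_eq_one (hP.ball_nonempty hL hr) fun b hb => IsProperLF.mem_ball.2 <| by
    linarith [hL.subadd t b, IsProperLF.mem_ball.1 hb]

theorem ballCutoff_eq_zero {L : G → ℝ} (hL : IsLengthFunction L) (hP : IsProperLF L)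
    {r : ℝ} {t : G} (ht : 5 * r < L t) : ballCutoff hP r t = 0 :=
  cutoff_eq_zero fun b hb h => by
    linarith [hL.le_add_mul t b, IsProperLF.mem_ball.1 hb, IsProperLF.mem_ball.1 h]

/-- The dyadic piece of `λ_f` at scale `r` has norm `O(‖[D, λ_f]‖ / r)`. -/
theorem convBound_dyadic {L : G → ℝ} (hL : IsLengthFunction L) (hP : IsProperLF L)
    {D : ℝ} (hD : 0 ≤ D)
    (hcard : ∀ r s : ℝ, 1 ≤ r → s ≤ 16 * r →
      ((hP.ball s).card : ℝ) ≤ D ^ 2 * (hP.ball r).card)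
    {f : G → ℂ} {N : ℝ} (hN : 0 ≤ N)
    (hf : ∀ S T, KernelBound (fun x y => ((L x : ℂ) - L y) * f (x * y⁻¹)) S T N)
    {r : ℝ} (hr : 1 ≤ r) (S T : Finset G) :
    ConvBound (fun t => f t * (ballCutoff hP (2 * r) t - ballCutoff hP r t)) S T
      (2 * (N / r * D * D)) := by
  have hr0 : 0 < r := by linarith
  set H := (hP.ball (16 * r)).filter fun x => 2 * r < L x with hH
  have hND : 0 ≤ N / r * D := by positivity
  have base : ∀ S T, ConvBound (fun t => f t * cutoff H (hP.ball r) t) S T (N / r * D) := by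
    refine ConvBound.mul_cutoff (by positivity) hD (hP.ball_nonempty hL hr0.le) ?_ ?_
    · refine le_trans ?_ (hcard r (16 * r) hr le_rfl)
      exact_mod_cast Finset.card_filter_le _ _
    · exact KernelBound.of_commutator (a := fun x y => f (x * y⁻¹)) hL.nonneg hr0 hN
        (fun x hx => (Finset.mem_filter.1 hx).2.le) (fun y hy => IsProperLF.mem_ball.1 hy) (hf _ _)
  have smooth : ∀ s : ℝ, 1 ≤ s → ConvBound
      (fun t => f t * cutoff H (hP.ball r) t * ballCutoff hP s t) S T (N / r * D * D) :=
    fun s hs => ConvBound.mul_cutoff hND hD (hP.ball_nonempty hL (by linarith))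
      (hcard s (4 * s) hs (by linarith)) (base (hP.ball (4 * s)) (hP.ball s)) S T
  have hfun : (fun t => f t * (ballCutoff hP (2 * r) t - ballCutoff hP r t))
      = fun t => f t * cutoff H (hP.ball r) t * ballCutoff hP (2 * r) t
        - f t * cutoff H (hP.ball r) t * ballCutoff hP r t := by
    funext t
    rcases le_or_gt (L t) (3 * r) with h3 | h3
    · rw [ballCutoff_eq_one hL hP (by linarith) (by linarith),
        ballCutoff_eq_one hL hP hr0.le h3]
      ring
    rcases le_or_gt (L t) (10 * r) with h10 | h10
    · rw [cutoff_eq_one (hP.ball_nonempty hL hr0.le)]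
      · ring
      intro b hb
      rw [IsProperLF.mem_ball] at hb
      rw [hH, Finset.mem_filter, IsProperLF.mem_ball]
      constructor <;> linarith [hL.subadd t b, hL.le_add_mul t b]
    · rw [ballCutoff_eq_zero hL hP (by linarith), ballCutoff_eq_zero hL hP (by linarith)]
      ring
  rw [hfun]
  exact ((smooth (2 * r) (by linarith)).sub (smooth r hr)).mono (two_mul _).ge

/-- If `‖[D, λ_f]‖ ≤ N` and `f` is small enough on a suitable finite set, then `λ_f` is small. -/
theorem exists_finset_convBound_le {L : G → ℝ} (hL : IsLengthFunction L)
    (hBD : HasBoundedDoubling L) {N ε : ℝ} (hN : 0 ≤ N) (hε : 0 < ε) :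
    ∃ B : Finset G, ∃ δ > 0, ∀ f : G →₀ ℂ,
      (∀ S T, KernelBound (fun x y => ((L x : ℂ) - L y) * f (x * y⁻¹)) S T N) →
      (∀ t ∈ B, ‖f t‖ ≤ δ) → ∀ S T, ConvBound f S T ε := by
  classical
  obtain ⟨D, hD, hcard⟩ := hBD.exists_card_ball_le
  have hP := hBD.1
  set c := 2 * (N * D * D) with hc
  have hc0 : 0 ≤ c := by positivity
  obtain ⟨J, hJ⟩ : ∃ J : ℕ, 2 * c / (ε / 2) < 2 ^ J := pow_unbounded_of_one_lt _ (by norm_num)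
  have hJ' : 2 * c / 2 ^ J ≤ ε / 2 := by
    rw [div_lt_iff₀ (by positivity)] at hJ
    rw [div_le_iff₀ (by positivity)]
    linarith
  set H := hP.ball (4 * 2 ^ J)
  set K := hP.ball (2 ^ J)
  have hone : ∀ n : ℕ, (1 : ℝ) ≤ 2 ^ n := fun n => one_le_pow₀ (by norm_num)
  set M : ℝ := H.card * K.card
  have hM : 0 ≤ M := by positivity
  refine ⟨Finset.image₂ (fun z w => z * w⁻¹) H K, ε / (2 * (M * D + 1)), by positivity, ?_⟩
  intro f hf hsmall S T
  have start : ∀ S T, ConvBound (fun t => f t * ballCutoff hP (2 ^ J) t) S T (ε / 2) := by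
    intro S T
    have hblock : ConvBound f H K (M * (ε / (2 * (M * D + 1)))) := by
      refine ConvBound.mono (KernelBound.of_sum_norm _ H K) ?_
      calc _ ≤ ∑ x ∈ H, ∑ y ∈ K, ε / (2 * (M * D + 1)) :=
            Finset.sum_le_sum fun x hx => Finset.sum_le_sum fun y hy =>
              hsmall _ (Finset.mem_image₂_of_mem hx hy)
        _ = _ := by simp [M, mul_assoc]
    refine ConvBound.mono (hblock.mul_cutoff (by positivity) hD
      (hP.ball_nonempty hL (by positivity)) (hcard _ _ (hone J) (by linarith [hone J])) S T) ?_
    have : M * (ε / (2 * (M * D + 1))) * D = ε / 2 * (M * D / (M * D + 1)) := by field_simp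
    rw [this]
    exact mul_le_of_le_one_right (by positivity) ((div_le_one (by positivity)).2 (by linarith))
  have telescope : ∀ n : ℕ, ∀ S T, ConvBound (fun t => f t * ballCutoff hP (2 ^ (J + n)) t) S T
      (ε / 2 + 2 * c / 2 ^ J - 2 * c / 2 ^ (J + n)) := by
    intro n
    induction n with
    | zero => exact fun S T => ConvBound.mono (start S T) (by simp)
    | succ n ih =>
      intro S T
      have hstep := convBound_dyadic hL hP hD hcard hN hf (hone (J + n)) S T
      have hfun : (fun t => f t * ballCutoff hP (2 ^ (J + (n + 1))) t)
          = fun t => f t * ballCutoff hP (2 ^ (J + n)) t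
            + f t * (ballCutoff hP (2 * 2 ^ (J + n)) t - ballCutoff hP (2 ^ (J + n)) t) := by
        funext t
        rw [← add_assoc, pow_succ' _ (J + n)]
        ring
      rw [hfun]
      refine ConvBound.mono (ConvBound.add (ih S T) hstep) (le_of_eq ?_)
      rw [← add_assoc, pow_succ' _ (J + n), hc]
      field_simp
      ring
  obtain ⟨n, hn⟩ : ∃ n : ℕ, ∑ t ∈ f.support, L t < 2 ^ n :=
    pow_unbounded_of_one_lt _ (by norm_num)
  have hfn : (fun t => f t * ballCutoff hP (2 ^ (J + n)) t) = f := by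
    funext t
    by_cases ht : t ∈ f.support
    · rw [ballCutoff_eq_one hL hP (by positivity), mul_one]
      have h1 := Finset.single_le_sum (f := L) (fun x _ => hL.nonneg x) ht
      have h2 : (2 : ℝ) ^ n ≤ 2 ^ (J + n) := pow_le_pow_right₀ (by norm_num) (by omega)
      linarith [hone (J + n)]
    · rw [Finsupp.notMem_support_iff.1 ht, zero_mul]
  have hfinal := telescope n S T
  rw [hfn] at hfinal
  refine ConvBound.mono hfinal ?_
  have : 0 ≤ 2 * c / 2 ^ (J + n) := by positivity
  linarith

/-- for a length function of bounded doubling, the set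
`{λ_f : f finitely supported, f(e) = 0, ‖[D, λ_f]‖ ≤ 1}` is totally bounded
for the operator norm on `B(ℓ²(G))`. -/
theorem totallyBounded_lipschitz_ball
    (L : G → ℝ) (hL : IsLengthFunction L) (hBD : HasBoundedDoubling L) :
    TotallyBounded {T : l2 G →L[ℂ] l2 G |
      ∃ f : G →₀ ℂ, f 1 = 0 ∧ IsConvOp (f : G → ℂ) T ∧
        ∃ Tc : l2 G →L[ℂ] l2 G, IsCommOp L (f : G → ℂ) Tc ∧ ‖Tc‖ ≤ 1} := by
  classical
  refine Metric.totallyBounded_of_finite_discretization fun ε hε => ?_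
  obtain ⟨B, δ, hδ, hB⟩ :=
    exists_finset_convBound_le hL hBD (N := 1 + 1) (by norm_num) (half_pos hε)
  choose φ hφ1 hφ T' hT' hT'1 using
    fun T : {T : l2 G →L[ℂ] l2 G | ∃ f : G →₀ ℂ, f 1 = 0 ∧ IsConvOp (f : G → ℂ) T ∧
      ∃ Tc : l2 G →L[ℂ] l2 G, IsCommOp L (f : G → ℂ) Tc ∧ ‖Tc‖ ≤ 1} => T.2
  set R : ℝ := ∑ t ∈ B, (L t)⁻¹
  have hinv : ∀ t, 0 ≤ (L t)⁻¹ := fun t => inv_nonneg.2 (hL.nonneg t)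
  have hφB : ∀ T, (fun t : B => φ T t) ∈ Metric.closedBall (0 : B → ℂ) R := by
    intro T
    rw [mem_closedBall_zero_iff,
      pi_norm_le_iff_of_nonneg (Finset.sum_nonneg fun t _ => hinv t)]
    intro t
    refine le_trans ?_ (Finset.single_le_sum (f := fun t => (L t)⁻¹) (fun t _ => hinv t) t.2)
    rcases eq_or_ne (t : G) 1 with h1 | h1
    · rw [h1, hφ1, norm_zero]
      exact hinv 1
    · have hpos : 0 < L t := (hL.nonneg t).lt_of_ne' fun h => h1 ((hL.eq_zero_iff _).1 h)
      rw [← one_div, le_div_iff₀ hpos, mul_comm]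
      exact ((hT' T).norm_apply_le hL t).trans (hT'1 T)
  obtain ⟨net, -, hfin, hnet⟩ :=
    finite_cover_balls_of_compact (isCompact_closedBall (0 : B → ℂ) R) (half_pos hδ)
  have hcenter : ∀ T, ∃ p : net, dist (fun t : B => φ T t) p < δ / 2 := fun T => by
    obtain ⟨p, hp, hTp⟩ := Set.mem_iUnion₂.1 (hnet (hφB T))
    exact ⟨⟨p, hp⟩, hTp⟩
  choose F hF using hcenter
  refine ⟨net, hfin.fintype, F, fun T₁ T₂ h => ?_⟩
  have hclose : ∀ t ∈ B, ‖(φ T₁ - φ T₂) t‖ ≤ δ := fun t ht => by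
    have h12 := dist_triangle_right (fun t : B => φ T₁ t) (fun t : B => φ T₂ t) (F T₁)
    have h1 := hF T₁
    have h2 := hF T₂
    rw [← h] at h2
    have ht' := dist_le_pi_dist (fun t : B => φ T₁ t) (fun t : B => φ T₂ t) ⟨t, ht⟩
    rw [dist_eq_norm] at ht'
    rw [Finsupp.sub_apply]
    linarith
  have hcomm : ∀ S T, KernelBound
      (fun x y => ((L x : ℂ) - L y) * (φ T₁ - φ T₂) (x * y⁻¹)) S T (1 + 1) := fun S T => by
    have := (((hT' T₁).kernelBound S T).mono (hT'1 T₁)).sub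
      (((hT' T₂).kernelBound S T).mono (hT'1 T₂))
    simpa only [Finsupp.sub_apply, mul_sub] using this
  rw [dist_eq_norm]
  refine (opNorm_le_of_kernelBound (half_pos hε).le fun S S' => ?_).trans_lt (half_lt_self hε)
  have := hB (φ T₁ - φ T₂) hcomm hclose S S'
  simpa only [ConvBound, Finsupp.sub_apply, sub_apply, lp.coeFn_sub,
    Pi.sub_apply, (hφ T₁).apply_single, (hφ T₂).apply_single] using this
end
end

section
/- Let G be a discrete group and L a length function on G. For every finitely supported f : G → ℂ and all real numbers r, s with 0 ≤ r < s, one has ‖(I − M_s) λ_f M_r‖ ≤ (s − r)⁻¹ · ‖[D, λ_f]‖. -/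
open scoped ENNReal ComplexConjugate

noncomputable section

variable {G : Type*}

variable [Group G]

/-- A finitely supported convolution kernel has finitely many nonzero entries in each row. -/
theorem finite_support_convKernel (f : G →₀ ℂ) (x : G) :
    {y : G | f (x * y⁻¹) ≠ 0}.Finite := by
  refine f.hasFiniteSupport.preimage (f := fun y : G => x * y⁻¹) ?_
  exact fun a _ b _ h => inv_injective (mul_left_cancel h)

/-- Pointwise commutator identity: if `η = D ζ`, then `D λ_f ζ = [D, λ_f] ζ + λ_f η`. -/
theorem IsCommOp.length_mul_convOp_apply {L : G → ℝ} {f : G →₀ ℂ} {T Tc : l2 G →L[ℂ] l2 G}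
    (hT : IsConvOp (f : G → ℂ) T) (hTc : IsCommOp L (f : G → ℂ) Tc) {ζ η : l2 G}
    (h : ∀ y, η y = (L y : ℂ) * ζ y) (x : G) :
    (L x : ℂ) * T ζ x = Tc ζ x + T η x := by
  have hfin := finite_support_convKernel f x
  rw [hT, hT, hTc, ← tsum_mul_left, ← Summable.tsum_add]
  · refine tsum_congr fun y => ?_
    rw [h]
    ring
  · refine summable_of_hasFiniteSupport (hfin.subset fun y hy hf => hy ?_)
    simp [hf]
  · refine summable_of_hasFiniteSupport (hfin.subset fun y hy hf => hy ?_)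
    simp [hf]

/-- On vectors supported in the ball of radius `r`, the operator `D = M_L` is defined and bounded
by `r`. -/
theorem exists_length_mul {L : G → ℝ} (hL : IsLengthFunction L) {r : ℝ} (hr : 0 ≤ r) {ζ : l2 G}
    (hζ : ∀ y, r < L y → ζ y = 0) :
    ∃ η : l2 G, (∀ y, η y = (L y : ℂ) * ζ y) ∧ ‖η‖ ≤ r * ‖ζ‖ := by
  have hle : ∀ y, ‖(L y : ℂ) * ζ y‖ ≤ ‖((r : ℂ) • ζ) y‖ := fun y => by
    rw [lp.coeFn_smul, Pi.smul_apply, smul_eq_mul, norm_mul, norm_mul, Complex.norm_real,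
      Complex.norm_real, Real.norm_of_nonneg (hL.nonneg y), Real.norm_of_nonneg hr]
    rcases lt_or_ge r (L y) with hy | hy
    · simp [hζ y hy]
    · gcongr
  refine ⟨⟨fun y => (L y : ℂ) * ζ y, (lp.memℓp ((r : ℂ) • ζ)).mono' hle⟩, fun y => rfl, ?_⟩
  refine (lp.norm_mono two_ne_zero hle).trans ?_
  rw [norm_smul, Complex.norm_real, Real.norm_of_nonneg hr]

/-- Truncating a vector to a set does not increase its norm. -/
theorem norm_truncation_le {X : Type*} {p : X → Prop} [DecidablePred p] {M : l2 X →L[ℂ] l2 X}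
    (hM : ∀ (ξ : l2 X) (x : X), M ξ x = if p x then ξ x else 0) (ξ : l2 X) : ‖M ξ‖ ≤ ‖ξ‖ := by
  refine lp.norm_mono two_ne_zero fun x => ?_
  rw [hM]
  split_ifs <;> simp

/-- the localized weighted inequality
`‖(I − M_s) λ_f M_r‖ ≤ (s − r)⁻¹ ‖[D, λ_f]‖` for `0 ≤ r < s`. -/
theorem norm_truncated_convOp_le
    (L : G → ℝ) (hL : IsLengthFunction L) (f : G →₀ ℂ) (r s : ℝ)
    (hr : 0 ≤ r) (hrs : r < s)
    (T Tc Ms Mr : l2 G →L[ℂ] l2 G)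
    (hT : IsConvOp (f : G → ℂ) T) (hTc : IsCommOp L (f : G → ℂ) Tc)
    (hMs : ∀ (ξ : l2 G) (x : G), Ms ξ x = if L x ≤ s then ξ x else 0)
    (hMr : ∀ (ξ : l2 G) (x : G), Mr ξ x = if L x ≤ r then ξ x else 0) :
    ‖((1 : l2 G →L[ℂ] l2 G) - Ms).comp (T.comp Mr)‖ ≤ (s - r)⁻¹ * ‖Tc‖ := by
  set X := ((1 : l2 G →L[ℂ] l2 G) - Ms).comp (T.comp Mr)
  have hX : ∀ (ξ : l2 G) (x : G), X ξ x = if L x ≤ s then 0 else T (Mr ξ) x := fun ξ x => by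
    change T (Mr ξ) x - Ms (T (Mr ξ)) x = _
    rw [hMs]
    split_ifs <;> simp
  have key : ∀ ξ, s * ‖X ξ‖ ≤ (‖Tc‖ + r * ‖X‖) * ‖ξ‖ := fun ξ => by
    have hζ := norm_truncation_le hMr ξ
    obtain ⟨η, hη, hηr⟩ := exists_length_mul hL hr (ζ := Mr ξ) fun y hy => by
      rw [hMr, if_neg hy.not_ge]
    have hMη : Mr η = η := lp.ext <| funext fun y => by
      rw [hMr, hη, hMr]
      split_ifs <;> simp
    have hpt : ∀ x, ‖((s : ℂ) • X ξ) x‖ ≤ ‖(Tc (Mr ξ) + X η) x‖ := fun x => by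
      rw [lp.coeFn_smul, Pi.smul_apply, lp.coeFn_add, Pi.add_apply, hX, hX, hMη]
      split_ifs with hx
      · simp
      · rw [← hTc.length_mul_convOp_apply hT hη, smul_eq_mul, norm_mul, norm_mul,
          Complex.norm_real, Complex.norm_real, Real.norm_of_nonneg (hL.nonneg x),
          Real.norm_of_nonneg (hr.trans hrs.le)]
        gcongr
        exact (not_le.mp hx).le
    calc s * ‖X ξ‖ = ‖(s : ℂ) • X ξ‖ := by
          rw [norm_smul, Complex.norm_real, Real.norm_of_nonneg (hr.trans hrs.le)]
      _ ≤ ‖Tc (Mr ξ) + X η‖ := lp.norm_mono two_ne_zero hpt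
      _ ≤ ‖Tc‖ * ‖Mr ξ‖ + ‖X‖ * ‖η‖ :=
          (norm_add_le _ _).trans (add_le_add (Tc.le_opNorm _) (X.le_opNorm _))
      _ ≤ ‖Tc‖ * ‖ξ‖ + ‖X‖ * (r * ‖ξ‖) := by
          gcongr
          exact hηr.trans (by gcongr)
      _ = (‖Tc‖ + r * ‖X‖) * ‖ξ‖ := by ring
  have hs : 0 < s := hr.trans_lt hrs
  have hnorm : ‖X‖ ≤ (‖Tc‖ + r * ‖X‖) / s :=
    X.opNorm_le_bound (by positivity) fun ξ => by
      rw [div_mul_eq_mul_div, le_div_iff₀ hs, mul_comm]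
      exact key ξ
  rw [le_div_iff₀ hs] at hnorm
  rw [inv_mul_eq_div, le_div_iff₀ (sub_pos.mpr hrs)]
  linarith
end
end

section
/- Let G be a discrete group and L a length function on G. For all finitely supported f, h, k : G → ℂ one has ‖[D, λ_{(h*∗k)·f}]‖ ≤ ‖h‖₂ · ‖k‖₂ · ‖[D, λ_f]‖, where (h*∗k)·f denotes the pointwise product of the convolution h*∗k with f. -/
open scoped ENNReal ComplexConjugate

noncomputable section

variable {G : Type*}

variable [Group G]

/-- The vector of `ℓ²(ι)` that agrees with `g` on the finite set `s` and vanishes elsewhere. -/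
def finVec {ι : Type*} [DecidableEq ι] (s : Finset ι) (g : ι → ℂ) : l2 ι :=
  ∑ i ∈ s, lp.single 2 i (g i)

section FinVec

variable {ι : Type*} [DecidableEq ι]

lemma finVec_apply (s : Finset ι) (g : ι → ℂ) (i : ι) :
    finVec s g i = if i ∈ s then g i else 0 := by
  have h : finVec s g i = ∑ j ∈ s, lp.single (E := fun _ : ι => ℂ) 2 j (g j) i :=
    (congrFun (lp.coeFn_sum _ s) i).trans (Finset.sum_apply i s _)
  rw [h]
  simp [Pi.single_apply]

lemma norm_finVec_sq (s : Finset ι) (g : ι → ℂ) :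
    ‖finVec s g‖ ^ 2 = ∑ i ∈ s, ‖g i‖ ^ 2 := by
  have h := lp.norm_sum_single (E := fun _ : ι => ℂ) (p := 2) (by norm_num) g s
  simpa [finVec] using h

lemma inner_finVec_left (s : Finset ι) (g : ι → ℂ) (w : l2 ι) :
    inner ℂ (finVec s g) w = ∑ i ∈ s, conj (g i) * w i := by
  simp [finVec, lp.inner_single_left, RCLike.inner_apply, mul_comm]

lemma tendsto_finVec (ξ : l2 ι) :
    Filter.Tendsto (fun s : Finset ι => finVec s ξ) Filter.atTop (nhds ξ) :=
  lp.hasSum_single (by norm_num) ξ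

/-- A bound on the sesquilinear form of `T` over finitely supported vectors bounds the norm. -/
lemma opNorm_le_of_finVec (T : l2 ι →L[ℂ] l2 ι) {C : ℝ} (hC : 0 ≤ C)
    (hT : ∀ (t s : Finset ι) (g e : ι → ℂ),
      ‖inner ℂ (finVec t g) (T (finVec s e))‖ ≤ C * (‖finVec t g‖ * ‖finVec s e‖)) :
    ‖T‖ ≤ C := by
  have key (η ξ : l2 ι) : ‖inner ℂ η (T ξ)‖ ≤ C * (‖η‖ * ‖ξ‖) := by
    have hη := tendsto_finVec η
    have hξ := tendsto_finVec ξ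
    have hTξ := (T.continuous.tendsto ξ).comp hξ
    exact le_of_tendsto_of_tendsto' (hη.inner hTξ).norm
      ((hη.norm.mul hξ.norm).const_mul C) fun s => hT s s η ξ
  refine T.opNorm_le_bound hC fun ξ => ?_
  have h := key (T ξ) ξ
  rw [inner_self_eq_norm_sq_to_K, norm_pow, RCLike.norm_ofReal, abs_norm] at h
  rcases (norm_nonneg (T ξ)).eq_or_lt with h0 | h0
  · rw [← h0]
    positivity
  · exact le_of_mul_le_mul_left (by linarith) h0

end FinVec

section Commutator

/-- `(h* ∗ k)(xy⁻¹) = ∑ u, conj (h (ux⁻¹)) k(uy⁻¹)`. -/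
lemma starConv_mul_inv (h k : G → ℂ) (x y : G) (U : Finset G)
    (hU : ∀ u ∉ U, k (u * y⁻¹) = 0) :
    starConv h k (x * y⁻¹) = ∑ u ∈ U, conj (h (u * x⁻¹)) * k (u * y⁻¹) := by
  rw [starConv, ← ((Equiv.inv G).trans (Equiv.mulLeft x)).tsum_eq,
    tsum_eq_sum (s := U) fun u hu => by simp [mul_assoc, hU u hu]]
  simp [mul_assoc]

variable [DecidableEq G]

lemma IsCommOp.apply_finVec {L : G → ℝ} {f : G → ℂ} {T : l2 G →L[ℂ] l2 G}
    (hT : IsCommOp L f T) (s : Finset G) (e : G → ℂ) (x : G) :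
    T (finVec s e) x = ∑ y ∈ s, ((L x : ℂ) - (L y : ℂ)) * f (x * y⁻¹) * e y := by
  rw [hT, tsum_eq_sum (s := s) fun y hy => by simp [finVec_apply, hy]]
  exact Finset.sum_congr rfl fun y hy => by simp [finVec_apply, hy]

lemma sum_norm_finVec_mul_sq_le (h : G →₀ ℂ) (U t : Finset G) (g : G → ℂ) :
    ∑ u ∈ U, ‖finVec t fun x => h (u * x⁻¹) * g x‖ ^ 2 ≤
      (l2norm (h : G → ℂ) * ‖finVec t g‖) ^ 2 := by
  have hsum : Summable fun x => ‖h x‖ ^ 2 :=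
    summable_of_ne_finset_zero (s := h.support) fun x hx => by
      simp [Finsupp.notMem_support_iff.mp hx]
  have hrow (x : G) : ∑ u ∈ U, ‖h (u * x⁻¹)‖ ^ 2 ≤ ∑' u, ‖h u‖ ^ 2 := by
    rw [← (Equiv.mulRight x⁻¹).tsum_eq]
    exact ((Equiv.mulRight x⁻¹).summable_iff.mpr hsum).sum_le_tsum U fun _ _ => by positivity
  rw [mul_pow, l2norm, Real.sq_sqrt (tsum_nonneg fun _ => by positivity), norm_finVec_sq,
    Finset.mul_sum]
  simp_rw [norm_finVec_sq, norm_mul, mul_pow]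
  rw [Finset.sum_comm]
  refine Finset.sum_le_sum fun x _ => ?_
  rw [← Finset.sum_mul]
  exact mul_le_mul_of_nonneg_right (hrow x) (by positivity)

end Commutator

/-- `‖[D, λ_{(h*∗k)·f}]‖ ≤ ‖h‖₂ ‖k‖₂ ‖[D, λ_f]‖`. -/
theorem norm_comm_conv_cutoff_le
    (L : G → ℝ) (hL : IsLengthFunction L) (f h k : G →₀ ℂ)
    (Tc Tc' : l2 G →L[ℂ] l2 G)
    (hTc : IsCommOp L (f : G → ℂ) Tc)
    (hTc' : IsCommOp L (fun x => starConv (h : G → ℂ) (k : G → ℂ) x * f x) Tc') :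
    ‖Tc'‖ ≤ l2norm (h : G → ℂ) * l2norm (k : G → ℂ) * ‖Tc‖ := by
  classical
  have hh : 0 ≤ l2norm (h : G → ℂ) := Real.sqrt_nonneg _
  have hk : 0 ≤ l2norm (k : G → ℂ) := Real.sqrt_nonneg _
  refine opNorm_le_of_finVec Tc' (by positivity) fun t s g e => ?_
  let U : Finset G := Finset.image₂ (· * ·) k.support s
  have hU (y : G) (hy : y ∈ s) (u : G) (hu : u ∉ U) : k (u * y⁻¹) = 0 := by
    by_contra hne
    exact hu (Finset.mem_image₂.mpr
      ⟨u * y⁻¹, Finsupp.mem_support_iff.mpr hne, y, hy, by simp⟩)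
  let a (u : G) : l2 G := finVec t fun x => h (u * x⁻¹) * g x
  let b (u : G) : l2 G := finVec s fun y => k (u * y⁻¹) * e y
  have hdecomp : inner ℂ (finVec t g) (Tc' (finVec s e)) =
      ∑ u ∈ U, inner ℂ (a u) (Tc (b u)) := by
    simp only [a, b, inner_finVec_left, hTc.apply_finVec, hTc'.apply_finVec]
    rw [Finset.sum_comm]
    refine Finset.sum_congr rfl fun x _ => ?_
    simp only [Finset.mul_sum]
    rw [Finset.sum_comm]
    refine Finset.sum_congr rfl fun y hy => ?_
    rw [starConv_mul_inv h k x y U (hU y hy), Finset.sum_mul, Finset.mul_sum, Finset.sum_mul,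
      Finset.mul_sum]
    refine Finset.sum_congr rfl fun u _ => ?_
    rw [(starRingEnd ℂ).map_mul]
    ring
  have ha : √(∑ u ∈ U, ‖a u‖ ^ 2) ≤ l2norm (h : G → ℂ) * ‖finVec t g‖ :=
    Real.sqrt_le_iff.mpr ⟨by positivity, sum_norm_finVec_mul_sq_le h U t g⟩
  have hb : √(∑ u ∈ U, ‖b u‖ ^ 2) ≤ l2norm (k : G → ℂ) * ‖finVec s e‖ :=
    Real.sqrt_le_iff.mpr ⟨by positivity, sum_norm_finVec_mul_sq_le k U s e⟩
  calc ‖inner ℂ (finVec t g) (Tc' (finVec s e))‖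
      = ‖∑ u ∈ U, inner ℂ (a u) (Tc (b u))‖ := by rw [hdecomp]
    _ ≤ ∑ u ∈ U, ‖Tc‖ * (‖a u‖ * ‖b u‖) := norm_sum_le_of_le U fun u _ =>
        calc ‖inner ℂ (a u) (Tc (b u))‖ ≤ ‖a u‖ * ‖Tc (b u)‖ := norm_inner_le_norm _ _
          _ ≤ ‖a u‖ * (‖Tc‖ * ‖b u‖) := by gcongr; exact Tc.le_opNorm _
          _ = ‖Tc‖ * (‖a u‖ * ‖b u‖) := by ring
    _ = ‖Tc‖ * ∑ u ∈ U, ‖a u‖ * ‖b u‖ := by rw [Finset.mul_sum]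
    _ ≤ ‖Tc‖ * (√(∑ u ∈ U, ‖a u‖ ^ 2) * √(∑ u ∈ U, ‖b u‖ ^ 2)) := by
        gcongr
        exact Real.sum_mul_le_sqrt_mul_sqrt U _ _
    _ ≤ ‖Tc‖ * ((l2norm (h : G → ℂ) * ‖finVec t g‖) *
          (l2norm (k : G → ℂ) * ‖finVec s e‖)) := by gcongr
    _ = l2norm (h : G → ℂ) * l2norm (k : G → ℂ) * ‖Tc‖ * (‖finVec t g‖ * ‖finVec s e‖) := by
        ring
end
end

section
/- Let G be a discrete group, L a length function on G, and f : G → ℂ finitely supported. If f(x) ≠ 0 for some x ≠ e, then J_D(f) ≠ 0. Consequently the seminorm J_D is a norm on the subspace { f : G → ℂ finitely supported : f(e) = 0 }. -/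
open scoped ENNReal ComplexConjugate

noncomputable section

variable {G : Type*}

variable [Group G]

/-- Composing with an injection and cutting off along a predicate preserves `ℓ²`, and does not
increase partial sums of squares. -/
theorem sum_cutoff_comp_le {α β : Type*} (φ : α → β) (hφ : Function.Injective φ)
    (p : α → Prop) [DecidablePred p] (ξ : l2 β) (s : Finset α) :
    ∑ x ∈ s, ‖if p x then ξ (φ x) else 0‖ ^ (2 : ℝ≥0∞).toReal ≤ ‖ξ‖ ^ (2 : ℝ≥0∞).toReal := by
  classical
  calc ∑ x ∈ s, ‖if p x then ξ (φ x) else 0‖ ^ (2 : ℝ≥0∞).toReal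
      ≤ ∑ x ∈ s, ‖ξ (φ x)‖ ^ (2 : ℝ≥0∞).toReal := by
        refine Finset.sum_le_sum fun x _ => ?_
        split_ifs <;> simp
    _ = ∑ y ∈ s.image φ, ‖ξ y‖ ^ (2 : ℝ≥0∞).toReal :=
        (Finset.sum_image (f := fun y => ‖ξ y‖ ^ (2 : ℝ≥0∞).toReal) hφ.injOn).symm
    _ ≤ ‖ξ‖ ^ (2 : ℝ≥0∞).toReal := lp.sum_rpow_le_norm_rpow (by simp) ξ _

/-- The operator `ξ ↦ χ_p · (ξ ∘ φ)` on `ℓ²` for an injection `φ`. -/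
def cutoffComp {α β : Type*} (φ : α → β) (hφ : Function.Injective φ)
    (p : α → Prop) [DecidablePred p] : l2 β →L[ℂ] l2 α :=
  LinearMap.mkContinuous
    { toFun := fun ξ => ⟨fun x => if p x then ξ (φ x) else 0,
        memℓp_gen' (sum_cutoff_comp_le φ hφ p ξ)⟩
      map_add' := fun ξ η => by
        ext x
        change (if p x then (ξ + η) (φ x) else 0)
          = (if p x then ξ (φ x) else 0) + (if p x then η (φ x) else 0)
        split_ifs <;> simp
      map_smul' := fun c ξ => by
        ext x
        change (if p x then (c • ξ) (φ x) else 0) = c • (if p x then ξ (φ x) else 0)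
        split_ifs <;> simp }
    1 fun ξ => by
      rw [one_mul]
      exact lp.norm_le_of_forall_sum_le (by simp) (norm_nonneg _) (sum_cutoff_comp_le φ hφ p ξ)

theorem cutoffComp_apply {α β : Type*} (φ : α → β) (hφ : Function.Injective φ)
    (p : α → Prop) [DecidablePred p] (ξ : l2 β) (x : α) :
    cutoffComp φ hφ p ξ x = if p x then ξ (φ x) else 0 := rfl

theorem norm_cutoffComp_le {α β : Type*} (φ : α → β) (hφ : Function.Injective φ)
    (p : α → Prop) [DecidablePred p] : ‖cutoffComp φ hφ p‖ ≤ 1 :=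
  LinearMap.mkContinuous_norm_le _ zero_le_one _

/-- The operator `(I − M_{2r}) λ_a M_r` for a group element `a`. -/
def truncTranslation (L : G → ℝ) (r : ℝ) (a : G) : l2 G →L[ℂ] l2 G :=
  cutoffComp (fun x => a⁻¹ * x) (mul_right_injective a⁻¹)
    (fun x => ¬ L x ≤ 2 * r ∧ L (a⁻¹ * x) ≤ r)

theorem mul_norm_truncTranslation_le {L : G → ℝ} (hL : IsLengthFunction L) {r : ℝ} (hr : 0 < r)
    (a : G) : r * ‖truncTranslation L r a‖ ≤ L a := by
  rcases le_total r (L a) with h | h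
  · have := norm_cutoffComp_le (fun x => a⁻¹ * x) (mul_right_injective a⁻¹)
      (fun x => ¬ L x ≤ 2 * r ∧ L (a⁻¹ * x) ≤ r)
    calc r * ‖truncTranslation L r a‖ ≤ r * 1 := by gcongr; exact this
      _ ≤ L a := by simpa using h
  · have : truncTranslation L r a = 0 := by
      ext ξ x
      rw [truncTranslation, cutoffComp_apply, if_neg]
      · simp
      · rintro ⟨h₁, h₂⟩
        have := hL.subadd a (a⁻¹ * x)
        rw [mul_inv_cancel_left] at this
        linarith
    simpa [this] using hL.nonneg a

/-- The operator `(I − M_{2r}) λ_f M_r` for finitely supported `f`. -/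
def truncConv (L : G → ℝ) (f : G →₀ ℂ) (r : ℝ) : l2 G →L[ℂ] l2 G :=
  ∑ a ∈ f.support, f a • truncTranslation L r a

theorem truncConv_apply (L : G → ℝ) (f : G →₀ ℂ) (r : ℝ) (ξ : l2 G) (x : G) :
    truncConv L f r ξ x = ∑ a ∈ f.support, f a * truncTranslation L r a ξ x := by
  simp only [truncConv, _root_.sum_apply, lp.coeFn_sum]
  exact Finset.sum_apply x f.support fun a => ⇑(f a • truncTranslation L r a ξ)

theorem isTruncOp_truncConv (L : G → ℝ) (f : G →₀ ℂ) (r : ℝ) :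
    IsTruncOp L f r (truncConv L f r) := by
  intro ξ x
  simp only [truncConv_apply, truncTranslation, cutoffComp_apply]
  split_ifs with h
  · simp [h]
  · let e : G ≃ G := (Equiv.inv G).trans (Equiv.mulRight x)
    rw [← e.tsum_eq, tsum_eq_sum (s := f.support)]
    · refine Finset.sum_congr rfl fun a _ => ?_
      simp [e, h]
    · intro a ha
      simp [e, Finsupp.notMem_support_iff.1 ha]

theorem IsTruncOp.eq_truncConv {L : G → ℝ} {f : G →₀ ℂ} {r : ℝ} {T : l2 G →L[ℂ] l2 G}
    (hT : IsTruncOp L f r T) : T = truncConv L f r := by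
  ext ξ x
  rw [hT ξ x, isTruncOp_truncConv L f r ξ x]

theorem mul_norm_truncConv_le {L : G → ℝ} (hL : IsLengthFunction L) (f : G →₀ ℂ) {r : ℝ}
    (hr : 0 < r) : r * ‖truncConv L f r‖ ≤ ∑ a ∈ f.support, ‖f a‖ * L a := by
  calc r * ‖truncConv L f r‖ ≤ r * ∑ a ∈ f.support, ‖f a • truncTranslation L r a‖ := by
        gcongr
        exact norm_sum_le _ _
    _ = ∑ a ∈ f.support, ‖f a‖ * (r * ‖truncTranslation L r a‖) := by
        rw [Finset.mul_sum]
        refine Finset.sum_congr rfl fun a _ => ?_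
        rw [norm_smul]
        ring
    _ ≤ ∑ a ∈ f.support, ‖f a‖ * L a := by
        gcongr
        exact mul_norm_truncTranslation_le hL hr _

/-- The supremum defining `J_D(f)` is finite. -/
theorem mul_norm_truncConv_le_JD {L : G → ℝ} (hL : IsLengthFunction L) (f : G →₀ ℂ) {r : ℝ}
    (hr : 0 < r) : r * ‖truncConv L f r‖ ≤ JD L f := by
  refine le_csSup ⟨∑ a ∈ f.support, ‖f a‖ * L a, ?_⟩
    ⟨r, hr, _, isTruncOp_truncConv L f r, rfl⟩
  rintro _ ⟨s, hs, T, hT, rfl⟩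
  rw [hT.eq_truncConv]
  exact mul_norm_truncConv_le hL f hs

theorem truncConv_ne_zero {L : G → ℝ} (hL : IsLengthFunction L) {f : G →₀ ℂ} {r : ℝ}
    (hr : 0 ≤ r) {x : G} (hx : 2 * r < L x) (hf : f x ≠ 0) : truncConv L f r ≠ 0 := by
  classical
  intro h
  have key := isTruncOp_truncConv L f r (lp.single 2 1 1) x
  have h1 : L 1 = 0 := (hL.eq_zero_iff 1).2 rfl
  rw [h, if_neg hx.not_ge, tsum_eq_single 1] at key
  · simp [h1, hr] at key
    exact hf key.symm
  · intro y hy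
    simp [hy]

theorem JD_pos {L : G → ℝ} (hL : IsLengthFunction L) {f : G →₀ ℂ} {x : G} (hx : x ≠ 1)
    (hf : f x ≠ 0) : 0 < JD L f := by
  have hLx : 0 < L x := (hL.nonneg x).lt_of_ne' (mt (hL.eq_zero_iff x).1 hx)
  have hr : 0 < L x / 3 := by positivity
  refine lt_of_lt_of_le (mul_pos hr (norm_pos_iff.2 ?_)) (mul_norm_truncConv_le_JD hL f hr)
  exact truncConv_ne_zero hL hr.le (by linarith) hf

theorem JD_zero (L : G → ℝ) : JD L ((0 : G →₀ ℂ) : G → ℂ) = 0 := by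
  have key : ∀ a ∈ {a : ℝ | ∃ r : ℝ, 0 < r ∧ ∃ T : l2 G →L[ℂ] l2 G,
      IsTruncOp L ((0 : G →₀ ℂ) : G → ℂ) r T ∧ a = r * ‖T‖}, a = 0 := by
    rintro _ ⟨r, -, T, hT, rfl⟩
    simp [hT.eq_truncConv, truncConv]
  exact le_antisymm (Real.sSup_nonpos fun a ha => (key a ha).le)
    (Real.sSup_nonneg fun a ha => (key a ha).ge)

/-- if `f x ≠ 0` for some `x ≠ e` then `J_D(f) ≠ 0`; consequently
`J_D` is a norm on `{f finitely supported : f(e) = 0}`. -/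
theorem JD_ne_zero
    (L : G → ℝ) (hL : IsLengthFunction L) :
    (∀ f : G →₀ ℂ, (∃ x : G, x ≠ 1 ∧ f x ≠ 0) → JD L (f : G → ℂ) ≠ 0) ∧
    (∀ f : G →₀ ℂ, f 1 = 0 → (JD L (f : G → ℂ) = 0 ↔ f = 0)) := by
  refine ⟨fun f ⟨x, hx, hf⟩ => (JD_pos hL hx hf).ne', fun f hf1 => ⟨fun h => ?_, ?_⟩⟩
  · by_contra hne
    obtain ⟨x, hx⟩ := Finsupp.ne_iff.1 hne
    exact (JD_pos hL (fun h1 => hx (by simp [h1, hf1])) hx).ne' h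
  · rintro rfl
    exact JD_zero L
end
end

section
/- Let G be a discrete group and L a length function on G. Fix r > 0, and suppose h, k : G → ℂ are finitely supported with h supported on G \ B(2r) and k supported on B(r). Then for every finitely supported f : G → ℂ one has ‖λ_{(h*∗k)·f}‖ ≤ r⁻¹ · ‖h‖₂ · ‖k‖₂ · J_D(f), where (h*∗k)·f denotes the pointwise product of the convolution h*∗k with f. -/
open scoped ENNReal ComplexConjugate

noncomputable section

variable {G : Type*}

variable [Group G]

section Auxiliary

theorem memℓp_two_of_sum_sq_le {α : Type*} {v : α → ℂ} {C : ℝ}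
    (hv : ∀ A : Finset α, ∑ x ∈ A, ‖v x‖ ^ 2 ≤ C) : Memℓp v 2 :=
  memℓp_gen' (C := C) fun A => by simpa using hv A

theorem l2_norm_sq_le {α : Type*} {v : l2 α} {C : ℝ}
    (hv : ∀ A : Finset α, ∑ x ∈ A, ‖v x‖ ^ 2 ≤ C) : ‖v‖ ^ 2 ≤ C := by
  have hC : 0 ≤ C := by simpa using hv ∅
  have : ‖v‖ ≤ Real.sqrt C := by
    refine lp.norm_le_of_forall_sum_le (by norm_num) (Real.sqrt_nonneg _) fun A => ?_
    simpa [Real.sq_sqrt hC] using hv A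
  calc ‖v‖ ^ 2 ≤ Real.sqrt C ^ 2 := by gcongr
    _ = C := Real.sq_sqrt hC

theorem sum_sq_le_l2_norm_sq {α : Type*} (v : l2 α) (A : Finset α) :
    ∑ x ∈ A, ‖v x‖ ^ 2 ≤ ‖v‖ ^ 2 := by
  simpa using lp.sum_rpow_le_norm_rpow (p := 2) (by norm_num) v A

theorem sum_sq_comp_le_l2_norm_sq {α : Type*} (v : l2 α) {ι : Type*} (A : Finset ι) (e : ι → α)
    (he : Function.Injective e) : ∑ x ∈ A, ‖v (e x)‖ ^ 2 ≤ ‖v‖ ^ 2 := by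
  simpa using sum_sq_le_l2_norm_sq v (A.map ⟨e, he⟩)

theorem l2norm_sq_finsupp {α : Type*} (h : α →₀ ℂ) :
    l2norm (h : α → ℂ) ^ 2 = ∑ a ∈ h.support, ‖h a‖ ^ 2 := by
  rw [l2norm, Real.sq_sqrt (tsum_nonneg fun _ => by positivity)]
  exact tsum_eq_sum fun a ha => by simp [Finsupp.notMem_support_iff.mp ha]

/-- The weighted left translation `ξ ↦ (x ↦ c x * ξ (s⁻¹ * x))` is a contraction of `ℓ²(G)`
when `‖c‖ ≤ 1`. -/
theorem exists_weighted_translation (s : G) (c : G → ℂ) (hc : ∀ x, ‖c x‖ ≤ 1) :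
    ∃ W : l2 G →L[ℂ] l2 G, ‖W‖ ≤ 1 ∧ ∀ ξ x, W ξ x = c x * ξ (s⁻¹ * x) := by
  have key (ξ : l2 G) (A : Finset G) : ∑ x ∈ A, ‖c x * ξ (s⁻¹ * x)‖ ^ 2 ≤ ‖ξ‖ ^ 2 := by
    refine le_trans (Finset.sum_le_sum fun x _ => ?_)
      (sum_sq_comp_le_l2_norm_sq ξ A _ (mul_right_injective s⁻¹))
    rw [norm_mul]
    gcongr
    exact mul_le_of_le_one_left (norm_nonneg _) (hc x)
  let W : l2 G →ₗ[ℂ] l2 G :=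
    { toFun := fun ξ => ⟨fun x => c x * ξ (s⁻¹ * x), memℓp_two_of_sum_sq_le (key ξ)⟩
      map_add' := fun ξ η => by
        ext x
        exact mul_add _ _ _
      map_smul' := fun a ξ => by
        ext x
        exact mul_left_comm _ _ _ }
  have hW (ξ : l2 G) : ‖W ξ‖ ≤ 1 * ‖ξ‖ := by
    rw [one_mul]
    exact (sq_le_sq₀ (norm_nonneg _) (norm_nonneg _)).1 (l2_norm_sq_le (key ξ))
  exact ⟨W.mkContinuous 1 hW, W.mkContinuous_norm_le zero_le_one hW, fun _ _ => rfl⟩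

theorem tsum_conv_eq_sum (f : G →₀ ℂ) (g : G → G → ℂ) (x : G)
    (hg : ∀ y, f (x * y⁻¹) = 0 → g (x * y⁻¹) y = 0) :
    ∑' y : G, g (x * y⁻¹) y = ∑ s ∈ f.support, g s (s⁻¹ * x) := by
  let e : G ≃ G := (Equiv.inv G).trans (Equiv.mulRight x)
  rw [← e.tsum_eq, tsum_eq_sum (s := f.support)]
  · simp [e]
  · intro s hs
    have := hg (s⁻¹ * x)
    simp_all [e]

theorem isTruncOp_iff (L : G → ℝ) (f : G →₀ ℂ) (r : ℝ) (T : l2 G →L[ℂ] l2 G) :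
    IsTruncOp L f r T ↔ ∀ (ξ : l2 G) (x : G), T ξ x = if L x ≤ 2 * r then 0
      else ∑ s ∈ f.support, if L (s⁻¹ * x) ≤ r then f s * ξ (s⁻¹ * x) else 0 := by
  refine forall₂_congr fun ξ x => ?_
  rw [tsum_conv_eq_sum f (fun s y => if L y ≤ r then f s * ξ y else 0) x
    fun y hy => by simp [hy]]

theorem exists_isTruncOp (L : G → ℝ) (f : G →₀ ℂ) (r : ℝ) :
    ∃ S : l2 G →L[ℂ] l2 G, IsTruncOp L f r S ∧ ‖S‖ ≤ ∑ s ∈ f.support, ‖f s‖ := by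
  choose W hW hWx using fun s : G => exists_weighted_translation s
    (fun x => if L x ≤ 2 * r then 0 else if L (s⁻¹ * x) ≤ r then 1 else 0)
    (fun x => by split_ifs <;> simp)
  refine ⟨∑ s ∈ f.support, f s • W s, (isTruncOp_iff ..).2 fun ξ x => ?_, ?_⟩
  · have : (∑ s ∈ f.support, f s • W s) ξ x = ∑ s ∈ f.support, f s * W s ξ x := by
      simp only [sum_apply, lp.coeFn_sum]
      exact Finset.sum_apply _ _ _
    rw [this]
    split_ifs with hx
    · exact Finset.sum_eq_zero fun s _ => by simp [hWx, hx]
    · exact Finset.sum_congr rfl fun s _ => by simp [hWx, hx]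
  · refine (norm_sum_le _ _).trans (Finset.sum_le_sum fun s _ => ?_)
    rw [norm_smul]
    exact mul_le_of_le_one_right (norm_nonneg _) (hW s)

theorem IsTruncOp.unique {L : G → ℝ} {f : G → ℂ} {r : ℝ} {S T : l2 G →L[ℂ] l2 G}
    (hS : IsTruncOp L f r S) (hT : IsTruncOp L f r T) : S = T := by
  ext ξ x
  rw [hS, hT]

theorem IsTruncOp.eq_zero_of_forall_le {L : G → ℝ} (hL : IsLengthFunction L) {f : G →₀ ℂ} {r : ℝ}
    (hr : ∀ s ∈ f.support, L s ≤ r) {T : l2 G →L[ℂ] l2 G} (hT : IsTruncOp L f r T) : T = 0 := by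
  rw [isTruncOp_iff] at hT
  ext ξ x
  rw [hT]
  split_ifs with hx
  · rfl
  · refine Finset.sum_eq_zero fun s hs => if_neg fun hsx => hx ?_
    have := hL.subadd s (s⁻¹ * x)
    rw [mul_inv_cancel_left] at this
    linarith [hr s hs]

theorem mul_norm_le_JD {L : G → ℝ} (hL : IsLengthFunction L) (f : G →₀ ℂ) {r : ℝ} (hr : 0 < r)
    {S : l2 G →L[ℂ] l2 G} (hS : IsTruncOp L f r S) : r * ‖S‖ ≤ JD L (f : G → ℂ) := by
  refine le_csSup ⟨(∑ s ∈ f.support, L s) * ∑ s ∈ f.support, ‖f s‖, ?_⟩ ⟨r, hr, S, hS, rfl⟩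
  have hR : 0 ≤ ∑ s ∈ f.support, L s := Finset.sum_nonneg fun s _ => hL.nonneg s
  rintro _ ⟨q, hq, T, hT, rfl⟩
  obtain ⟨S', hS', hn⟩ := exists_isTruncOp L f q
  obtain rfl := hT.unique hS'
  rcases le_total (∑ s ∈ f.support, L s) q with h | h
  · rw [hT.eq_zero_of_forall_le hL fun s hs =>
      (Finset.single_le_sum (fun s _ => hL.nonneg s) hs).trans h]
    rw [norm_zero, mul_zero]
    exact mul_nonneg hR (Finset.sum_nonneg fun s _ => norm_nonneg _)
  · gcongr

theorem starConv_finsupp (h : G →₀ ℂ) (k : G → ℂ) (x : G) :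
    starConv h k x = ∑ a ∈ h.support, conj (h a) * k (a * x) := by
  rw [starConv, ← (Equiv.inv G).tsum_eq, tsum_eq_sum (s := h.support)]
  · simp
  · intro a ha
    simp [Finsupp.notMem_support_iff.mp ha]

theorem IsConvOp.apply_eq_sum {φ : G → ℂ} {f : G →₀ ℂ} {T : l2 G →L[ℂ] l2 G}
    (hT : IsConvOp (fun x => φ x * f x) T) (ξ : l2 G) (x : G) :
    T ξ x = ∑ s ∈ f.support, φ s * f s * ξ (s⁻¹ * x) := by
  rw [hT, tsum_conv_eq_sum f (fun s y => φ s * f s * ξ y) x fun y hy => by simp [hy]]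

/-- The vectors `y ↦ k y⁻¹ * ξ (y * t⁻¹)`, whose squared norms sum to at most
`‖k‖₂² * ‖ξ‖²`. -/
theorem exists_cutoff_translates (k : G →₀ ℂ) (ξ : l2 G) :
    ∃ v : G → l2 G, (∀ t y, v t y = k y⁻¹ * ξ (y * t⁻¹)) ∧
      ∀ F : Finset G, ∑ t ∈ F, ‖v t‖ ^ 2 ≤ l2norm (k : G → ℂ) ^ 2 * ‖ξ‖ ^ 2 := by
  classical
  have key (t : G) (A : Finset G) : ∑ y ∈ A, ‖k y⁻¹ * ξ (y * t⁻¹)‖ ^ 2 ≤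
      ∑ b ∈ k.support, ‖k b‖ ^ 2 * ‖ξ (b⁻¹ * t⁻¹)‖ ^ 2 := by
    have h1 : ∑ y ∈ A, ‖k y⁻¹ * ξ (y * t⁻¹)‖ ^ 2 =
        ∑ b ∈ A.map (Equiv.inv G).toEmbedding, ‖k b‖ ^ 2 * ‖ξ (b⁻¹ * t⁻¹)‖ ^ 2 := by
      simp [mul_pow]
    rw [h1]
    refine (Finset.sum_le_sum_of_subset_of_nonneg Finset.subset_union_right
      fun _ _ _ => by positivity).trans_eq
      (Finset.sum_subset (Finset.subset_union_left (s₁ := k.support)) fun b _ hb => ?_).symm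
    simp [Finsupp.notMem_support_iff.mp hb]
  let v (t : G) : l2 G := ⟨fun y => k y⁻¹ * ξ (y * t⁻¹), memℓp_two_of_sum_sq_le (key t)⟩
  have hv (t : G) : ‖v t‖ ^ 2 ≤ ∑ b ∈ k.support, ‖k b‖ ^ 2 * ‖ξ (b⁻¹ * t⁻¹)‖ ^ 2 :=
    l2_norm_sq_le (key t)
  refine ⟨v, fun _ _ => rfl, fun F => ?_⟩
  refine (Finset.sum_le_sum fun t _ => hv t).trans ?_
  rw [Finset.sum_comm, l2norm_sq_finsupp, Finset.sum_mul]
  refine Finset.sum_le_sum fun b _ => ?_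
  rw [← Finset.mul_sum]
  gcongr
  exact sum_sq_comp_le_l2_norm_sq ξ F _ ((mul_right_injective b⁻¹).comp inv_injective)

theorem IsConvOp.apply_eq_sum_truncOp {L : G → ℝ} (hL : IsLengthFunction L) {r : ℝ}
    {h k f : G →₀ ℂ} (hh : ∀ x : G, L x ≤ 2 * r → h x = 0) (hk : ∀ x : G, ¬ L x ≤ r → k x = 0)
    {T S : l2 G →L[ℂ] l2 G} (hT : IsConvOp (fun x => starConv h k x * f x) T)
    (hS : IsTruncOp L f r S) {ξ : l2 G} {v : G → l2 G}
    (hv : ∀ t y, v t y = k y⁻¹ * ξ (y * t⁻¹)) (x : G) :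
    T ξ x = ∑ a ∈ h.support, conj (h a) * S (v (x⁻¹ * a⁻¹)) a⁻¹ := by
  rw [isTruncOp_iff] at hS
  simp_rw [hT.apply_eq_sum, starConv_finsupp, Finset.sum_mul]
  rw [Finset.sum_comm]
  refine Finset.sum_congr rfl fun a ha => ?_
  have hLa : ¬ L a⁻¹ ≤ 2 * r := by
    rw [hL.inv_eq]
    exact fun h' => Finsupp.mem_support_iff.mp ha (hh a h')
  rw [hS, if_neg hLa, Finset.mul_sum]
  refine Finset.sum_congr rfl fun s _ => ?_
  have hLs : L (s⁻¹ * a⁻¹) = L (a * s) := by rw [← mul_inv_rev, hL.inv_eq]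
  have hvs : v (x⁻¹ * a⁻¹) (s⁻¹ * a⁻¹) = k (a * s) * ξ (s⁻¹ * x) := by
    rw [hv]
    simp [mul_assoc]
  rw [hLs, hvs]
  split_ifs with hs
  · ring
  · simp [hk _ hs]

end Auxiliary

/-- if `h` is supported on `G \ B(2r)` and `k` on `B(r)`, then
`‖λ_{(h*∗k)·f}‖ ≤ r⁻¹ ‖h‖₂ ‖k‖₂ J_D(f)`. -/
theorem norm_convOp_cutoff_le_JD
    (L : G → ℝ) (hL : IsLengthFunction L) (r : ℝ) (hr : 0 < r)
    (h k : G →₀ ℂ)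
    (hh : ∀ x : G, L x ≤ 2 * r → h x = 0)
    (hk : ∀ x : G, ¬ L x ≤ r → k x = 0)
    (f : G →₀ ℂ) (T : l2 G →L[ℂ] l2 G)
    (hT : IsConvOp (fun x => starConv (h : G → ℂ) (k : G → ℂ) x * f x) T) :
    ‖T‖ ≤ r⁻¹ * l2norm (h : G → ℂ) * l2norm (k : G → ℂ) * JD L (f : G → ℂ) := by
  classical
  obtain ⟨S, hS, -⟩ := exists_isTruncOp L f r
  have hh0 : 0 ≤ l2norm (h : G → ℂ) := Real.sqrt_nonneg _
  have hk0 : 0 ≤ l2norm (k : G → ℂ) := Real.sqrt_nonneg _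
  have hTS : ‖T‖ ≤ l2norm (h : G → ℂ) * l2norm (k : G → ℂ) * ‖S‖ := by
    refine T.opNorm_le_bound (by positivity) fun ξ => ?_
    refine (sq_le_sq₀ (norm_nonneg _) (by positivity)).1 (l2_norm_sq_le fun X => ?_)
    obtain ⟨v, hv, hv_sum⟩ := exists_cutoff_translates k ξ
    have pointwise (x : G) : ‖T ξ x‖ ^ 2 ≤ l2norm (h : G → ℂ) ^ 2 *
        ∑ a ∈ h.support, ‖S (v (x⁻¹ * a⁻¹)) a⁻¹‖ ^ 2 := by
      rw [hT.apply_eq_sum_truncOp hL hh hk hS hv, l2norm_sq_finsupp]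
      refine le_trans ?_ (Finset.sum_mul_sq_le_sq_mul_sq _ _ _)
      gcongr
      refine (norm_sum_le _ _).trans_eq (Finset.sum_congr rfl fun a _ => ?_)
      simp
    let F : Finset G := (X ×ˢ h.support).image fun p => p.1⁻¹ * p.2⁻¹
    have reindex : ∑ x ∈ X, ∑ a ∈ h.support, ‖S (v (x⁻¹ * a⁻¹)) a⁻¹‖ ^ 2 ≤
        ∑ t ∈ F, ∑ a ∈ h.support, ‖S (v t) a⁻¹‖ ^ 2 := by
      rw [Finset.sum_comm, Finset.sum_comm (s := F)]
      refine Finset.sum_le_sum fun a ha => ?_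
      have inj : Function.Injective fun x : G => x⁻¹ * a⁻¹ :=
        (mul_left_injective a⁻¹).comp inv_injective
      rw [← Finset.sum_image (f := fun t => ‖S (v t) a⁻¹‖ ^ 2) (inj.injOn (s := ↑X))]
      refine Finset.sum_le_sum_of_subset_of_nonneg ?_ fun _ _ _ => by positivity
      intro t ht
      obtain ⟨x, hx, rfl⟩ := Finset.mem_image.mp ht
      exact Finset.mem_image.mpr ⟨(x, a), Finset.mk_mem_product hx ha, rfl⟩
    calc ∑ x ∈ X, ‖T ξ x‖ ^ 2
        ≤ l2norm (h : G → ℂ) ^ 2 *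
          ∑ x ∈ X, ∑ a ∈ h.support, ‖S (v (x⁻¹ * a⁻¹)) a⁻¹‖ ^ 2 := by
          rw [Finset.mul_sum]
          exact Finset.sum_le_sum fun x _ => pointwise x
      _ ≤ l2norm (h : G → ℂ) ^ 2 * ∑ t ∈ F, (‖S‖ * ‖v t‖) ^ 2 := by
          gcongr
          refine reindex.trans (Finset.sum_le_sum fun t _ => ?_)
          refine (sum_sq_comp_le_l2_norm_sq _ _ _ inv_injective).trans ?_
          gcongr
          exact S.le_opNorm _
      _ ≤ l2norm (h : G → ℂ) ^ 2 * (‖S‖ ^ 2 * (l2norm (k : G → ℂ) ^ 2 * ‖ξ‖ ^ 2)) := by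
          simp_rw [mul_pow, ← Finset.mul_sum]
          gcongr
          exact hv_sum F
      _ = (l2norm (h : G → ℂ) * l2norm (k : G → ℂ) * ‖S‖ * ‖ξ‖) ^ 2 := by ring
  calc ‖T‖ ≤ l2norm (h : G → ℂ) * l2norm (k : G → ℂ) * ‖S‖ := hTS
    _ = r⁻¹ * l2norm (h : G → ℂ) * l2norm (k : G → ℂ) * (r * ‖S‖) := by
        field_simp
    _ ≤ r⁻¹ * l2norm (h : G → ℂ) * l2norm (k : G → ℂ) * JD L (f : G → ℂ) := by
        gcongr
        exact mul_norm_le_JD hL f hr hS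
end
end
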